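/- In a differential category with antiderivatives, the First Fundamental Theorem of Calculus holds at the monoidal unit: d_R s_R = 1_{!R}, where (by the strictness identification !R ⊗ R = !R) both d_R and s_R are maps !R → !R. -/

import Mathlib

universe u v

/-- A symmetric strict monoidal category (data and the coherence axioms that
do not require transport along object equalities). Composition `comp f g`
is in diagrammatic order: first `f`, then `g`. -/
structure SMCData where
  Obj : Type u
  Hom : Obj → Obj → Type v
  id : ∀ A : Obj, Hom A A
  comp : ∀ {A B C : Obj}, Hom A B → Hom B C → Hom A C
  id_comp : ∀ {A B : Obj} (f : Hom A B), comp (id A) f = f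
  comp_id : ∀ {A B : Obj} (f : Hom A B), comp f (id B) = f
  comp_assoc : ∀ {A B C D : Obj} (f : Hom A B) (g : Hom B C) (h : Hom C D),
    comp (comp f g) h = comp f (comp g h)
  ten : Obj → Obj → Obj
  unit : Obj
  tHom : ∀ {A B C D : Obj}, Hom A C → Hom B D → Hom (ten A B) (ten C D)
  tHom_id : ∀ (A B : Obj), tHom (id A) (id B) = id (ten A B)
  tHom_comp : ∀ {A₁ A₂ A₃ B₁ B₂ B₃ : Obj} (f : Hom A₁ A₂) (g : Hom A₂ A₃)
    (f' : Hom B₁ B₂) (g' : Hom B₂ B₃),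
    tHom (comp f g) (comp f' g') = comp (tHom f f') (tHom g g')
  tenAssoc : ∀ (A B C : Obj), ten (ten A B) C = ten A (ten B C)
  unit_ten : ∀ (A : Obj), ten unit A = A
  ten_unit : ∀ (A : Obj), ten A unit = A
  sw : ∀ (A B : Obj), Hom (ten A B) (ten B A)
  sw_natural : ∀ {A B C D : Obj} (f : Hom A C) (g : Hom B D),
    comp (tHom f g) (sw C D) = comp (sw A B) (tHom g f)
  sw_sw : ∀ (A B : Obj), comp (sw A B) (sw B A) = id (ten A B)

/-- The identity morphism transported along an equality of objects. In a
strict monoidal category the structural isomorphisms are identities, so these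
are used to express the strictness identifications. -/
def SMCData.cHom (C : SMCData) {A B : C.Obj} (h : A = B) : C.Hom A B := by
  cases h; exact C.id A
/-- A differential category: an additive symmetric strict monoidal category with a coalgebra modality and a deriving transformation. -/
structure DiffCat extends SMCData where
  -- strictness coherence: associativity and unit identifications are
  -- (transported) identities compatible with the tensor of morphisms,
  -- and the symmetry satisfies the (strict) hexagon identity
  assoc_natural : ∀ {A₁ A₂ B₁ B₂ C₁ C₂ : Obj} (f : Hom A₁ A₂) (g : Hom B₁ B₂) (h : Hom C₁ C₂),
    comp (tHom (tHom f g) h) (toSMCData.cHom (tenAssoc A₂ B₂ C₂)) =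
      comp (toSMCData.cHom (tenAssoc A₁ B₁ C₁)) (tHom f (tHom g h))
  unit_ten_natural : ∀ {A B : Obj} (f : Hom A B),
    comp (tHom (id unit) f) (toSMCData.cHom (unit_ten B)) =
      comp (toSMCData.cHom (unit_ten A)) f
  ten_unit_natural : ∀ {A B : Obj} (f : Hom A B),
    comp (tHom f (id unit)) (toSMCData.cHom (ten_unit B)) =
      comp (toSMCData.cHom (ten_unit A)) f
  hexagon : ∀ (A B C : Obj),
    comp (toSMCData.cHom (tenAssoc A B C))
      (comp (tHom (id A) (sw B C))
        (comp (toSMCData.cHom (tenAssoc A C B).symm)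
          (comp (tHom (sw A C) (id B)) (toSMCData.cHom (tenAssoc C A B))))) =
      sw (ten A B) C
  -- additive enrichment: hom-sets are commutative monoids and composition
  -- and tensor preserve the additive structure
  add : ∀ {A B : Obj}, Hom A B → Hom A B → Hom A B
  zero : ∀ {A B : Obj}, Hom A B
  add_assoc : ∀ {A B : Obj} (f g h : Hom A B), add (add f g) h = add f (add g h)
  add_comm : ∀ {A B : Obj} (f g : Hom A B), add f g = add g f
  add_zero : ∀ {A B : Obj} (f : Hom A B), add f zero = f
  comp_add : ∀ {A B C : Obj} (f : Hom A B) (g h : Hom B C),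
    comp f (add g h) = add (comp f g) (comp f h)
  add_comp : ∀ {A B C : Obj} (f g : Hom A B) (h : Hom B C),
    comp (add f g) h = add (comp f h) (comp g h)
  comp_zero : ∀ {A B C : Obj} (f : Hom A B), comp f (zero : Hom B C) = zero
  zero_comp : ∀ {A B C : Obj} (f : Hom B C), comp (zero : Hom A B) f = zero
  tHom_add_left : ∀ {A B C D : Obj} (f g : Hom A C) (h : Hom B D),
    tHom (add f g) h = add (tHom f h) (tHom g h)
  tHom_add_right : ∀ {A B C D : Obj} (f : Hom A C) (g h : Hom B D),
    tHom f (add g h) = add (tHom f g) (tHom f h)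
  tHom_zero_left : ∀ {A B C D : Obj} (h : Hom B D),
    tHom (zero : Hom A C) h = zero
  tHom_zero_right : ∀ {A B C D : Obj} (f : Hom A C),
    tHom f (zero : Hom B D) = zero
  -- a coalgebra modality: a comonad (bang, rho, eps) with natural
  -- cocommutative comonoid structure (cmul, cunit) on each bang A,
  -- for which each rho A is a comonoid morphism
  bang : Obj → Obj
  bangMap : ∀ {A B : Obj}, Hom A B → Hom (bang A) (bang B)
  bangMap_id : ∀ (A : Obj), bangMap (id A) = id (bang A)
  bangMap_comp : ∀ {A B C : Obj} (f : Hom A B) (g : Hom B C),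
    bangMap (comp f g) = comp (bangMap f) (bangMap g)
  rho : ∀ (A : Obj), Hom (bang A) (bang (bang A))
  eps : ∀ (A : Obj), Hom (bang A) A
  cmul : ∀ (A : Obj), Hom (bang A) (ten (bang A) (bang A))
  cunit : ∀ (A : Obj), Hom (bang A) unit
  rho_natural : ∀ {A B : Obj} (f : Hom A B),
    comp (bangMap f) (rho B) = comp (rho A) (bangMap (bangMap f))
  eps_natural : ∀ {A B : Obj} (f : Hom A B),
    comp (bangMap f) (eps B) = comp (eps A) f
  cmul_natural : ∀ {A B : Obj} (f : Hom A B),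
    comp (bangMap f) (cmul B) = comp (cmul A) (tHom (bangMap f) (bangMap f))
  cunit_natural : ∀ {A B : Obj} (f : Hom A B),
    comp (bangMap f) (cunit B) = cunit A
  rho_eps : ∀ (A : Obj), comp (rho A) (eps (bang A)) = id (bang A)
  rho_bangMap_eps : ∀ (A : Obj), comp (rho A) (bangMap (eps A)) = id (bang A)
  rho_rho : ∀ (A : Obj), comp (rho A) (rho (bang A)) = comp (rho A) (bangMap (rho A))
  cmul_coassoc : ∀ (A : Obj),
    comp (cmul A) (comp (tHom (cmul A) (id (bang A)))
      (toSMCData.cHom (tenAssoc (bang A) (bang A) (bang A)))) =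
    comp (cmul A) (tHom (id (bang A)) (cmul A))
  cmul_counit_left : ∀ (A : Obj),
    comp (cmul A) (comp (tHom (cunit A) (id (bang A)))
      (toSMCData.cHom (unit_ten (bang A)))) = id (bang A)
  cmul_counit_right : ∀ (A : Obj),
    comp (cmul A) (comp (tHom (id (bang A)) (cunit A))
      (toSMCData.cHom (ten_unit (bang A)))) = id (bang A)
  cmul_cocomm : ∀ (A : Obj), comp (cmul A) (sw (bang A) (bang A)) = cmul A
  rho_cmul : ∀ (A : Obj),
    comp (rho A) (cmul (bang A)) = comp (cmul A) (tHom (rho A) (rho A))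
  rho_cunit : ∀ (A : Obj), comp (rho A) (cunit (bang A)) = cunit A
  -- a deriving transformation [d.1]-[d.5]
  der : ∀ (A : Obj), Hom (ten (bang A) A) (bang A)
  der_natural : ∀ {A B : Obj} (f : Hom A B),
    comp (tHom (bangMap f) f) (der B) = comp (der A) (bangMap f)
  -- [d.1] constant rule
  der_cunit : ∀ (A : Obj), comp (der A) (cunit A) = zero
  -- [d.2] Leibniz rule
  der_cmul : ∀ (A : Obj),
    comp (der A) (cmul A) =
      add
        (comp (tHom (cmul A) (id A))
          (comp (toSMCData.cHom (tenAssoc (bang A) (bang A) A))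
            (comp (tHom (id (bang A)) (sw (bang A) A))
              (comp (toSMCData.cHom (tenAssoc (bang A) A (bang A)).symm)
                (tHom (der A) (id (bang A)))))))
        (comp (tHom (cmul A) (id A))
          (comp (toSMCData.cHom (tenAssoc (bang A) (bang A) A))
            (tHom (id (bang A)) (der A))))
  -- [d.3] linear rule
  der_eps : ∀ (A : Obj),
    comp (der A) (eps A) = comp (tHom (cunit A) (id A)) (toSMCData.cHom (unit_ten A))
  -- [d.4] chain rule
  der_rho : ∀ (A : Obj),
    comp (der A) (rho A) =
      comp (tHom (cmul A) (id A))
        (comp (toSMCData.cHom (tenAssoc (bang A) (bang A) A))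
          (comp (tHom (rho A) (der A)) (der (bang A))))
  -- [d.5] interchange rule
  der_interchange : ∀ (A : Obj),
    comp (tHom (der A) (id A)) (der A) =
      comp (toSMCData.cHom (tenAssoc (bang A) A A))
        (comp (tHom (id (bang A)) (sw A A))
          (comp (toSMCData.cHom (tenAssoc (bang A) A A).symm)
            (comp (tHom (der A) (id A)) (der A))))

def DiffCat.cHom (C : DiffCat) {A B : C.Obj} (h : A = B) : C.Hom A B :=
  C.toSMCData.cHom h

namespace DiffCat

variable (C : DiffCat)

/-- The coderiving transformation d°_A := Δ_A (1 ⊗ ε_A). -/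
def dcirc (A : C.Obj) : C.Hom (C.bang A) (C.ten (C.bang A) A) :=
  C.comp (C.cmul A) (C.tHom (C.id (C.bang A)) (C.eps A))

/-- K_A := d°_A d_A + !(0). -/
def K (A : C.Obj) : C.Hom (C.bang A) (C.bang A) :=
  C.add (C.comp (C.dcirc A) (C.der A)) (C.bangMap (C.zero : C.Hom A A))

/-- J_A := d°_A d_A + 1_{!A}. -/
def J (A : C.Obj) : C.Hom (C.bang A) (C.bang A) :=
  C.add (C.comp (C.dcirc A) (C.der A)) (C.id (C.bang A))

/-- The deriving transformation at the monoidal unit, under the strictness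
identification !R ⊗ R = !R. -/
def dR : C.Hom (C.bang C.unit) (C.bang C.unit) :=
  C.comp (C.cHom (C.ten_unit (C.bang C.unit)).symm) (C.der C.unit)

/-- The coderiving transformation at the monoidal unit, under the strictness
identification !R ⊗ R = !R. -/
def dcircR : C.Hom (C.bang C.unit) (C.bang C.unit) :=
  C.comp (C.dcirc C.unit) (C.cHom (C.ten_unit (C.bang C.unit)))

end DiffCat

local infixr:80 "≫" => SMCData.comp _
local infixr:90 "⊠" => SMCData.tHom _

namespace SMCData

variable (S : SMCData)

theorem cHom_self {A : S.Obj} (h : A = A) : S.cHom h = S.id A := rfl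

theorem cHom_comp_cHom {A B D : S.Obj} (h : A = B) (k : B = D) :
    S.cHom h ≫ S.cHom k = S.cHom (h.trans k) := by
  subst h k
  exact S.id_comp _

theorem cHom_comp_cHom_assoc {A B D E : S.Obj} (h : A = B) (k : B = D) (f : S.Hom D E) :
    S.cHom h ≫ S.cHom k ≫ f = S.cHom (h.trans k) ≫ f := by
  rw [← S.comp_assoc, cHom_comp_cHom]

theorem cHom_tHom_id {A B D : S.Obj} (h : A = B) :
    S.cHom h ⊠ S.id D = S.cHom (congrArg (S.ten · D) h) := by
  subst h
  exact S.tHom_id _ _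

theorem id_tHom_cHom {A B D : S.Obj} (h : A = B) :
    S.id D ⊠ S.cHom h = S.cHom (congrArg (S.ten D) h) := by
  subst h
  exact S.tHom_id _ _

theorem comp_tHom_id {A B D E : S.Obj} (f : S.Hom A B) (g : S.Hom B D) :
    (f ≫ g) ⊠ S.id E = (f ⊠ S.id E) ≫ (g ⊠ S.id E) := by
  rw [← S.tHom_comp, S.id_comp]

theorem id_tHom_comp {A B D E : S.Obj} (f : S.Hom A B) (g : S.Hom B D) :
    S.id E ⊠ (f ≫ g) = (S.id E ⊠ f) ≫ (S.id E ⊠ g) := by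
  rw [← S.tHom_comp, S.id_comp]

theorem tHom_id_comp_id_tHom {A B D E : S.Obj} (f : S.Hom A B) (g : S.Hom D E) :
    (f ⊠ S.id D) ≫ (S.id B ⊠ g) = f ⊠ g := by
  rw [← S.tHom_comp, S.id_comp, S.comp_id]

theorem id_tHom_comp_tHom_id {A B D E : S.Obj} (f : S.Hom A B) (g : S.Hom D E) :
    (S.id A ⊠ g) ≫ (f ⊠ S.id E) = f ⊠ g := by
  rw [← S.tHom_comp, S.id_comp, S.comp_id]

end SMCData

namespace DiffCat

open SMCData

variable (C : DiffCat)

theorem assoc_symm_natural {A₁ A₂ B₁ B₂ C₁ C₂ : C.Obj}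
    (f : C.Hom A₁ A₂) (g : C.Hom B₁ B₂) (h : C.Hom C₁ C₂) :
    (f ⊠ g ⊠ h) ≫ C.toSMCData.cHom (C.tenAssoc A₂ B₂ C₂).symm =
      C.toSMCData.cHom (C.tenAssoc A₁ B₁ C₁).symm ≫ ((f ⊠ g) ⊠ h) := by
  have key := congrArg
    (fun k => C.toSMCData.cHom (C.tenAssoc A₁ B₁ C₁).symm ≫ k ≫
      C.toSMCData.cHom (C.tenAssoc A₂ B₂ C₂).symm) (C.assoc_natural f g h)
  simp only [C.comp_assoc, cHom_comp_cHom, cHom_comp_cHom_assoc, cHom_self, C.comp_id,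
    C.id_comp] at key
  exact key.symm

/-- The symmetry of the unit with itself is the identity. -/
theorem sw_unit_unit : C.sw C.unit C.unit = C.id (C.ten C.unit C.unit) := by
  let S := C.toSMCData
  have left : S.id C.unit ⊠ C.sw C.unit C.unit =
      S.cHom (C.unit_ten _) ≫ C.sw C.unit C.unit ≫ S.cHom (C.unit_ten _).symm := by
    rw [← C.comp_assoc, ← C.unit_ten_natural, C.comp_assoc, cHom_comp_cHom, cHom_self, C.comp_id]
  have right : C.sw C.unit C.unit ⊠ S.id C.unit =
      S.cHom (C.ten_unit _) ≫ C.sw C.unit C.unit ≫ S.cHom (C.ten_unit _).symm := by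
    rw [← C.comp_assoc, ← C.ten_unit_natural, C.comp_assoc, cHom_comp_cHom, cHom_self, C.comp_id]
  have hex := C.hexagon C.unit C.unit C.unit
  have sw_sw_assoc {X : C.Obj} (f : C.Hom _ X) :
      C.sw C.unit C.unit ≫ C.sw C.unit C.unit ≫ f = f := by
    rw [← C.comp_assoc, C.sw_sw, C.id_comp]
  rw [left, right] at hex
  simp only [S, C.comp_assoc, cHom_comp_cHom_assoc, cHom_comp_cHom, cHom_self, C.id_comp,
    C.comp_id, sw_sw_assoc] at hex
  have nat := C.sw_natural (S.cHom (C.unit_ten C.unit)) (S.id C.unit)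
  rw [← hex, id_tHom_cHom, cHom_tHom_id, cHom_comp_cHom] at nat
  have key := congrArg
    (fun k => S.cHom (congrArg (S.ten · C.unit) (C.unit_ten C.unit)).symm ≫ k) nat
  simp only [S, cHom_comp_cHom_assoc, cHom_comp_cHom, cHom_self, C.id_comp] at key
  exact key

/-- The Leibniz and linear rules combined: `d d° = (d° ⊗ 1)(1 ⊗ σ)(d ⊗ 1) + 1`. -/
theorem der_comp_dcirc (A : C.Obj) :
    C.der A ≫ C.dcirc A =
      C.add
        ((C.dcirc A ⊠ C.id A) ≫ C.toSMCData.cHom (C.tenAssoc (C.bang A) A A) ≫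
          (C.id (C.bang A) ⊠ C.sw A A) ≫
          C.toSMCData.cHom (C.tenAssoc (C.bang A) A A).symm ≫ (C.der A ⊠ C.id A))
        (C.id (C.ten (C.bang A) A)) := by
  unfold dcirc
  rw [← C.comp_assoc, C.der_cmul, C.add_comp]
  congr 1
  · simp only [C.comp_assoc, comp_tHom_id]
    congr 1
    rw [tHom_id_comp_id_tHom, ← id_tHom_comp_tHom_id C.toSMCData (C.der A) (C.eps A),
      ← C.tHom_id]
    simp only [← C.comp_assoc]
    congr 1
    simp only [C.comp_assoc]
    rw [← C.assoc_symm_natural, ← C.comp_assoc (_ ⊠ _) (_ ⊠ _), ← id_tHom_comp,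
      ← C.sw_natural, id_tHom_comp]
    simp only [C.comp_assoc]
    rw [← C.comp_assoc (C.toSMCData.cHom _), ← C.assoc_natural, C.comp_assoc]
  · simp only [C.comp_assoc]
    rw [← id_tHom_comp, C.der_eps, id_tHom_comp, ← C.comp_assoc (C.toSMCData.cHom _),
      ← C.assoc_natural, C.comp_assoc, id_tHom_cHom, cHom_comp_cHom,
      ← cHom_tHom_id C.toSMCData (C.ten_unit (C.bang A)), ← comp_tHom_id, ← comp_tHom_id,
      C.cmul_counit_right, C.tHom_id]

theorem dcirc_natural {A B : C.Obj} (f : C.Hom A B) :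
    C.bangMap f ≫ C.dcirc B = C.dcirc A ≫ (C.bangMap f ⊠ f) := by
  unfold dcirc
  rw [← C.comp_assoc, C.cmul_natural, C.comp_assoc, C.comp_assoc, ← C.tHom_comp,
    ← C.tHom_comp, C.eps_natural, C.comp_id, C.id_comp]

theorem J_natural {A B : C.Obj} (f : C.Hom A B) :
    C.bangMap f ≫ C.J B = C.J A ≫ C.bangMap f := by
  unfold J
  rw [C.comp_add, C.add_comp, ← C.comp_assoc, C.dcirc_natural, C.comp_assoc, C.der_natural,
    C.comp_assoc, C.comp_id, C.id_comp]

theorem dcirc_dcirc_assoc (A : C.Obj) :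
    C.dcirc A ≫ (C.dcirc A ⊠ C.id A) ≫ C.toSMCData.cHom (C.tenAssoc (C.bang A) A A) =
      C.cmul A ≫ (C.id (C.bang A) ⊠ (C.cmul A ≫ (C.eps A ⊠ C.eps A))) := by
  have h : (C.id (C.bang A) ⊠ C.eps A) ≫ (C.dcirc A ⊠ C.id A) =
      (C.cmul A ⊠ C.id (C.bang A)) ≫ ((C.id (C.bang A) ⊠ C.eps A) ⊠ C.eps A) := by
    rw [id_tHom_comp_tHom_id, ← C.tHom_comp, C.id_comp, dcirc]
  rw [dcirc, C.comp_assoc, ← dcirc, ← C.comp_assoc (_ ⊠ _), h, C.comp_assoc, C.assoc_natural,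
    id_tHom_comp, ← C.comp_assoc (C.cmul A) (_ ⊠ C.cmul A), ← C.cmul_coassoc]
  simp only [C.comp_assoc]

/-- Cocommutativity makes iterated coderivation symmetric. -/
theorem dcirc_dcirc_sw (A : C.Obj) :
    C.dcirc A ≫ (C.dcirc A ⊠ C.id A) ≫ C.toSMCData.cHom (C.tenAssoc (C.bang A) A A) ≫
        (C.id (C.bang A) ⊠ C.sw A A) =
      C.dcirc A ≫ (C.dcirc A ⊠ C.id A) ≫ C.toSMCData.cHom (C.tenAssoc (C.bang A) A A) := by
  have h := C.dcirc_dcirc_assoc A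
  rw [h, ← C.comp_assoc (_ ⊠ _), ← C.comp_assoc, h, C.comp_assoc, ← id_tHom_comp,
    C.comp_assoc, C.sw_natural, ← C.comp_assoc (C.cmul A) (C.sw _ _), C.cmul_cocomm]

theorem bangMap_zero_comp_dcirc (A : C.Obj) :
    C.bangMap (C.zero : C.Hom A A) ≫ C.dcirc A = C.zero := by
  rw [dcirc_natural, C.tHom_zero_right, C.comp_zero]

theorem der_comp_bangMap_zero (A : C.Obj) :
    C.der A ≫ C.bangMap (C.zero : C.Hom A A) = C.zero := by
  rw [← C.der_natural, C.tHom_zero_right, C.zero_comp]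

theorem K_comp_dcirc (A : C.Obj) :
    C.K A ≫ C.dcirc A = C.dcirc A ≫ (C.J A ⊠ C.id A) := by
  have h := congrArg
    (fun k => k ≫ C.toSMCData.cHom (C.tenAssoc (C.bang A) A A).symm ≫ (C.der A ⊠ C.id A))
    (C.dcirc_dcirc_sw A)
  simp only [C.comp_assoc, cHom_comp_cHom_assoc, cHom_self, C.id_comp] at h
  rw [K, J, C.add_comp, C.bangMap_zero_comp_dcirc, C.add_zero, C.comp_assoc, C.der_comp_dcirc,
    C.comp_add, h, C.tHom_add_left, C.tHom_id, C.comp_add, comp_tHom_id]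

theorem der_comp_K (A : C.Obj) : C.der A ≫ C.K A = C.der A ≫ C.dcirc A ≫ C.der A := by
  rw [K, C.comp_add, C.der_comp_bangMap_zero, C.add_zero]

theorem dcircR_comp_dR : C.dcircR ≫ C.dR = C.dcirc C.unit ≫ C.der C.unit := by
  simp only [dcircR, dR, DiffCat.cHom, C.comp_assoc, cHom_comp_cHom_assoc, cHom_self, C.id_comp]

theorem dR_comp_dcircR : C.dR ≫ C.dcircR = C.J C.unit := by
  have h := C.ten_unit_natural (C.dcirc C.unit ≫ C.der C.unit)
  rw [comp_tHom_id, C.comp_assoc] at h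
  rw [dR, dcircR, C.comp_assoc, ← C.comp_assoc (C.der _), C.der_comp_dcirc, C.sw_unit_unit,
    C.tHom_id]
  simp only [DiffCat.cHom, C.id_comp, C.comp_assoc, cHom_comp_cHom_assoc, cHom_self, C.add_comp,
    C.comp_add, h, cHom_comp_cHom, J]

/-- The endomorphism `J_A` has a left inverse as soon as `K_{!A}` has one. -/
theorem exists_comp_J_eq_id (A : C.Obj) (L : C.Hom (C.bang (C.bang A)) (C.bang (C.bang A)))
    (hL : L ≫ C.K (C.bang A) = C.id _) :
    ∃ G : C.Hom (C.bang A) (C.bang A), G ≫ C.J A = C.id (C.bang A) := by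
  refine ⟨C.rho A ≫ L ≫ C.dcirc (C.bang A) ≫ (C.bangMap (C.eps A) ⊠ C.cunit A) ≫
    C.toSMCData.cHom (C.ten_unit (C.bang A)), ?_⟩
  have h : (C.bangMap (C.eps A) ⊠ C.cunit A) ≫ (C.J A ⊠ C.id C.unit) =
      (C.J (C.bang A) ⊠ C.id (C.bang A)) ≫ (C.bangMap (C.eps A) ⊠ C.cunit A) := by
    rw [← C.tHom_comp, ← C.tHom_comp, C.J_natural, C.comp_id, C.id_comp]
  have h' : (C.rho A ⊠ C.rho A) ≫ (C.id _ ⊠ C.eps _) ≫ (C.bangMap (C.eps A) ⊠ C.cunit A) =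
      C.id (C.bang A) ⊠ C.cunit A := by
    rw [← C.tHom_comp, ← C.tHom_comp, C.id_comp, C.rho_bangMap_eps, ← C.comp_assoc, C.rho_eps,
      C.id_comp]
  simp only [C.comp_assoc]
  rw [← C.ten_unit_natural, ← C.comp_assoc (_ ⊠ _), h, C.comp_assoc,
    ← C.comp_assoc (C.dcirc _), ← C.K_comp_dcirc, C.comp_assoc, ← C.comp_assoc L, hL, C.id_comp,
    dcirc, C.comp_assoc, ← C.comp_assoc (C.rho A), C.rho_cmul, C.comp_assoc,
    ← C.comp_assoc (C.id _ ⊠ _), ← C.comp_assoc (C.rho A ⊠ _), h', C.cmul_counit_right]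

end DiffCat

/-- The First Fundamental Theorem of Calculus at the monoidal unit: in a
differential category with antiderivatives, d_R s_R = 1_{!R}, where
s_R := K_R⁻¹ d°_R (using the strictness identification !R ⊗ R = !R). -/
theorem statement8 (C : DiffCat)
    (Kinv : ∀ A : C.Obj, C.Hom (C.bang A) (C.bang A))
    (hK1 : ∀ A : C.Obj, C.comp (C.K A) (Kinv A) = C.id (C.bang A))
    (hK2 : ∀ A : C.Obj, C.comp (Kinv A) (C.K A) = C.id (C.bang A)) :
    C.comp C.dR (C.comp (Kinv C.unit) C.dcircR) = C.id (C.bang C.unit) := by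
  obtain ⟨G, hG⟩ := C.exists_comp_J_eq_id C.unit (Kinv _) (hK2 _)
  have dR_K : C.comp C.dR (C.K C.unit) = C.comp C.dR (C.comp C.dcircR C.dR) := by
    rw [C.dcircR_comp_dR, DiffCat.dR, C.comp_assoc, C.comp_assoc, C.der_comp_K]
  have J_cancel : C.comp (C.J C.unit) (C.comp C.dR (C.comp (Kinv C.unit) C.dcircR)) =
      C.J C.unit := by
    rw [← C.dR_comp_dcircR, ← C.comp_assoc _ C.dR, C.comp_assoc C.dR, ← dR_K, C.comp_assoc,
      ← C.comp_assoc (C.K _), hK1, C.id_comp]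
  rw [← C.id_comp (C.comp C.dR _), ← hG, C.comp_assoc, J_cancel]
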